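/- Let P be a finite poset, K a field, and V a nonzero pre-interval representation of P. Then V is indecomposable; indeed, the endomorphism algebra End(V) (natural transformations from V to itself) is one-dimensional over K. -/

import Mathlib

open Classical

structure PRep (K : Type) [Field K] (P : Type) [PartialOrder P] : Type 1 where
  V : P → Type
  [isAddCommGroup : ∀ x, AddCommGroup (V x)]
  [isModule : ∀ x, Module K (V x)]
  [isFinite : ∀ x, Module.Finite K (V x)]
  map : ∀ {x y : P}, x ≤ y → (V x →ₗ[K] V y)
  map_refl : ∀ x : P, map (le_refl x) = LinearMap.id
  map_trans : ∀ {x y z : P} (hxy : x ≤ y) (hyz : y ≤ z),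
    map (le_trans hxy hyz) = (map hyz).comp (map hxy)

attribute [instance] PRep.isAddCommGroup PRep.isModule PRep.isFinite

variable {K : Type} [Field K] {P : Type} [PartialOrder P]

namespace PRep

/-- Isomorphism of representations. -/
def Iso (M N : PRep K P) : Prop :=
  ∃ e : ∀ x : P, M.V x ≃ₗ[K] N.V x,
    ∀ (x y : P) (h : x ≤ y),
      (N.map h).comp (e x : M.V x →ₗ[K] N.V x)
        = (e y : M.V y →ₗ[K] N.V y).comp (M.map h)

/-- Pointwise direct sum of two representations. -/
def dsum (M N : PRep K P) : PRep K P where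
  V x := M.V x × N.V x
  map h := (M.map h).prodMap (N.map h)
  map_refl x := by
    apply LinearMap.ext; intro v
    simp [M.map_refl, N.map_refl]
  map_trans hxy hyz := by
    apply LinearMap.ext; intro v
    simp [M.map_trans hxy hyz, N.map_trans hxy hyz]

def IsThin (M : PRep K P) : Prop := ∀ x : P, Module.finrank K (M.V x) ≤ 1

def supp (M : PRep K P) : Set P := {x : P | Nontrivial (M.V x)}

def Indecomposable (M : PRep K P) : Prop :=
  (∃ x : P, Nontrivial (M.V x)) ∧
  ∀ N₁ N₂ : PRep K P, M.Iso (N₁.dsum N₂) →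
    (∀ x : P, Subsingleton (N₁.V x)) ∨ (∀ x : P, Subsingleton (N₂.V x))

end PRep

/-- Convexity of a subset of a poset. -/
def IsConvexSet (I : Set P) : Prop :=
  ∀ ⦃a b c : P⦄, a ∈ I → c ∈ I → a ≤ b → b ≤ c → b ∈ I

/-- Connectedness of a subset of a poset. -/
def IsConnectedSet (I : Set P) : Prop :=
  ∀ a ∈ I, ∀ b ∈ I,
    Relation.ReflTransGen (fun u v : P => u ∈ I ∧ v ∈ I ∧ (u ≤ v ∨ v ≤ u)) a b

/-- An interval of a poset: nonempty, convex and connected subset. -/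
def IsIntervalSet (I : Set P) : Prop :=
  I.Nonempty ∧ IsConvexSet I ∧ IsConnectedSet I

/-- The interval representation associated to a convex subset `I`. -/
noncomputable def intervalRep (K : Type) [Field K] {P : Type} [PartialOrder P]
    (I : Set P) (hI : IsConvexSet I) : PRep K P where
  V x := ↥(if x ∈ I then (⊤ : Submodule K K) else ⊥)
  map {x y} h :=
    { toFun := fun v => ⟨if y ∈ I then (v : K) else 0, by
        by_cases hy : y ∈ I <;>
          simp only [hy, if_true, if_false, Submodule.mem_top, Submodule.zero_mem]⟩
      map_add' := fun v w => by
        apply Subtype.ext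
        by_cases hy : y ∈ I <;> simp [hy]
      map_smul' := fun c v => by
        apply Subtype.ext
        by_cases hy : y ∈ I <;> simp [hy] }
  map_refl x := by
    apply LinearMap.ext; intro v
    apply Subtype.ext
    by_cases hx : x ∈ I
    · simp [hx]
    · have hv0 : (v : K) = 0 := by
        simpa only [hx, if_false, Submodule.mem_bot] using v.2
      show (if x ∈ I then (v : K) else 0) = (v : K)
      rw [if_neg hx, hv0]
  map_trans {x y z} hxy hyz := by
    apply LinearMap.ext; intro v
    apply Subtype.ext
    by_cases hz : z ∈ I
    · by_cases hy : y ∈ I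
      · show (if z ∈ I then (v : K) else 0) =
          if z ∈ I then (if y ∈ I then (v : K) else 0) else 0
        rw [if_pos hz, if_pos hz, if_pos hy]
      · by_cases hx : x ∈ I
        · exact absurd (hI hx hz hxy hyz) hy
        · have hv0 : (v : K) = 0 := by
            simpa only [hx, if_false, Submodule.mem_bot] using v.2
          simp [hz, hy, hv0]
    · simp [hz]

namespace PRep

def IsPreInterval (M : PRep K P) : Prop :=
  M.IsThin ∧ IsIntervalSet M.supp ∧
    ∀ (x y : P) (h : x ≤ y), x ∈ M.supp → y ∈ M.supp → M.map h ≠ 0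

end PRep

/-- The endomorphism space of a representation: families of linear maps
commuting with the structure maps, as a submodule of the product space. -/
def PRep.endSpace {K : Type} [Field K] {P : Type} [PartialOrder P]
    (M : PRep K P) : Submodule K (∀ x : P, M.V x →ₗ[K] M.V x) where
  carrier := {f | ∀ (x y : P) (h : x ≤ y), (M.map h).comp (f x) = (f y).comp (M.map h)}
  add_mem' := by
    intro f g hf hg x y h
    simp only [Pi.add_apply, LinearMap.comp_add, LinearMap.add_comp, hf x y h, hg x y h]
  zero_mem' := by
    intro x y h
    simp only [Pi.zero_apply, LinearMap.comp_zero, LinearMap.zero_comp]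
  smul_mem' := by
    intro c f hf x y h
    simp only [Pi.smul_apply, LinearMap.comp_smul, LinearMap.smul_comp, hf x y h]

/-- An endomorphism of a space of dimension at most one is a scalar. -/
theorem LinearMap.exists_eq_smul_id_of_finrank_le_one {K V : Type*} [Field K] [AddCommGroup V]
    [Module K V] [Module.Finite K V] (h : Module.finrank K V ≤ 1) (f : V →ₗ[K] V) :
    ∃ c : K, f = c • LinearMap.id := by
  obtain ⟨v, hv⟩ := finrank_le_one_iff.mp h
  obtain ⟨c, hc⟩ := hv (f v)
  refine ⟨c, LinearMap.ext fun w => ?_⟩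
  obtain ⟨d, rfl⟩ := hv w
  simp [← hc]

namespace PRep

/-- Scalars by which an endomorphism acts at comparable vertices joined by a nonzero map agree. -/
theorem scalar_eq_of_map_ne_zero {M : PRep K P} {f : ∀ x : P, M.V x →ₗ[K] M.V x}
    (hf : f ∈ M.endSpace) {x y : P} (h : x ≤ y) (hne : M.map h ≠ 0) {c d : K}
    (hc : f x = c • LinearMap.id) (hd : f y = d • LinearMap.id) : c = d := by
  have key := hf x y h
  rw [hc, hd, LinearMap.comp_smul, LinearMap.smul_comp, LinearMap.comp_id,
    LinearMap.id_comp] at key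
  exact smul_left_injective K hne key

/-- Every endomorphism of a pre-interval representation is a scalar. -/
theorem IsPreInterval.exists_eq_smul_id {M : PRep K P} (hM : M.IsPreInterval)
    {f : ∀ x : P, M.V x →ₗ[K] M.V x} (hf : f ∈ M.endSpace) :
    ∃ c : K, ∀ x : P, f x = c • LinearMap.id := by
  obtain ⟨hthin, ⟨⟨a, ha⟩, -, hconn⟩, hne⟩ := hM
  obtain ⟨c, hc⟩ := LinearMap.exists_eq_smul_id_of_finrank_le_one (hthin a) (f a)
  refine ⟨c, fun x => ?_⟩
  by_cases hx : x ∈ M.supp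
  · induction hconn a ha x hx with
    | refl => exact hc
    | @tail u v _ huv ih =>
      obtain ⟨hu, hv, huv⟩ := huv
      obtain ⟨d, hd⟩ := LinearMap.exists_eq_smul_id_of_finrank_le_one (hthin v) (f v)
      suffices c = d by rw [this, hd]
      rcases huv with h | h
      · exact scalar_eq_of_map_ne_zero hf h (hne u v h hu hv) (ih hu) hd
      · exact (scalar_eq_of_map_ne_zero hf h (hne v u h hv hu) hd (ih hu)).symm
  · have : Subsingleton (M.V x) := not_nontrivial_iff_subsingleton.mp hx
    exact LinearMap.ext fun v => Subsingleton.elim _ _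

/-- The identity endomorphism. -/
theorem id_mem_endSpace (M : PRep K P) :
    (fun _ => LinearMap.id : ∀ x : P, M.V x →ₗ[K] M.V x) ∈ M.endSpace :=
  fun _ _ _ => rfl

/-- A nonzero representation whose endomorphisms are all scalars is indecomposable. -/
theorem indecomposable_of_forall_exists_eq_smul_id {M : PRep K P}
    (hM0 : ∃ x, Nontrivial (M.V x))
    (hM : ∀ f ∈ M.endSpace, ∃ c : K, ∀ x : P, f x = c • LinearMap.id) :
    M.Indecomposable := by
  refine ⟨hM0, fun N₁ N₂ hiso => ?_⟩
  obtain ⟨e, hnat⟩ : ∃ e : ∀ x : P, M.V x ≃ₗ[K] N₁.V x × N₂.V x,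
      ∀ (x y : P) (h : x ≤ y) (v : M.V x),
        e y (M.map h v) = (N₁.map h (e x v).1, N₂.map h (e x v).2) := by
    obtain ⟨e, he⟩ := hiso
    exact ⟨e, fun x y h v => (LinearMap.congr_fun (he x y h) v).symm⟩
  obtain ⟨c, hc⟩ := hM
    (fun x => (e x).symm.toLinearMap ∘ₗ
      (LinearMap.inl K (N₁.V x) (N₂.V x) ∘ₗ LinearMap.fst K (N₁.V x) (N₂.V x)) ∘ₗ
        (e x).toLinearMap) (by
      refine fun x y h => LinearMap.ext fun v => (e y).injective ?_
      change e y (M.map h ((e x).symm ((e x v).1, 0))) =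
        e y ((e y).symm ((e y (M.map h v)).1, 0))
      rw [hnat, (e y).apply_symm_apply, hnat, (e x).apply_symm_apply, map_zero])
  have hproj : ∀ (x : P) (a : N₁.V x) (b : N₂.V x), a = c • a ∧ 0 = c • b := by
    intro x a b
    have h : (e x).symm ((e x ((e x).symm (a, b))).1, 0) = c • (e x).symm (a, b) :=
      LinearMap.congr_fun (hc x) ((e x).symm (a, b))
    rw [(e x).apply_symm_apply, ← map_smul] at h
    exact Prod.ext_iff.mp ((e x).symm.injective h)
  by_cases hc0 : c = 0
  · exact Or.inl fun x => subsingleton_of_forall_eq 0 fun a => by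
      simpa [hc0] using (hproj x a 0).1
  · exact Or.inr fun x => subsingleton_of_forall_eq 0 fun b =>
      (smul_eq_zero.mp (hproj x 0 b).2.symm).resolve_left hc0

/-- A nonzero representation whose endomorphisms are all scalars has a one-dimensional
endomorphism space. -/
theorem finrank_endSpace_eq_one {M : PRep K P} (hM0 : ∃ x, Nontrivial (M.V x))
    (hM : ∀ f ∈ M.endSpace, ∃ c : K, ∀ x : P, f x = c • LinearMap.id) :
    Module.finrank K M.endSpace = 1 := by
  refine finrank_eq_one (⟨_, M.id_mem_endSpace⟩ : M.endSpace) (fun h => ?_) fun f => ?_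
  · obtain ⟨x, hx⟩ := hM0
    obtain ⟨v, hv⟩ := exists_ne (0 : M.V x)
    exact hv (LinearMap.congr_fun (congrFun (Subtype.ext_iff.mp h) x) v)
  · obtain ⟨c, hc⟩ := hM f f.2
    exact ⟨c, Subtype.ext (funext fun x => (hc x).symm)⟩

end PRep

/-- A nonzero pre-interval representation of a finite poset is
indecomposable; indeed its endomorphism algebra is one-dimensional. -/
theorem preinterval_indecomposable_end_one_dim (P : Type) [PartialOrder P]
    [Fintype P] (K : Type) [Field K] (V : PRep K P)
    (hV0 : ∃ x, Nontrivial (V.V x)) (hV : V.IsPreInterval) :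
    V.Indecomposable ∧ Module.finrank K V.endSpace = 1 := by
  have hscalar := fun f hf => hV.exists_eq_smul_id (f := f) hf
  exact ⟨PRep.indecomposable_of_forall_exists_eq_smul_id hV0 hscalar,
    PRep.finrank_endSpace_eq_one hV0 hscalar⟩
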